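/- Fix an index j with ‖Pφ_j‖ ≥ τ and assume Pφ_l ≠ c·Pφ_q for all indices l ≠ q and all real scalars c. If x ∈ X satisfies Px = Pφ_j and x ≠ φ_j, and the series ∑_i w_i|⟨x,φ_i⟩| converges, then ∑_i w_i|⟨x,φ_i⟩| > w_j; hence φ_j is the unique minimizer of the weighted ℓ¹ functional over {x : Px = Pφ_j}. -/

import Mathlib

open scoped RealInnerProductSpace

/-- The Cauchy–Schwarz inequality is strict for nonparallel vectors. -/
theorem abs_real_inner_lt_norm_mul_norm {X : Type*} [NormedAddCommGroup X]
    [InnerProductSpace ℝ X] {a b : X} (hb : b ≠ 0) (h : ∀ c : ℝ, a ≠ c • b) :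
    |⟪a, b⟫| < ‖a‖ * ‖b‖ := by
  refine lt_of_le_of_ne (abs_real_inner_le_norm a b) fun heq => ?_
  have ha : a ≠ 0 := by simpa using h 0
  rw [real_inner_comm, mul_comm, ← Real.norm_eq_abs, norm_inner_eq_norm_iff hb ha] at heq
  obtain ⟨r, -, hr⟩ := heq
  exact h r hr

/-- If `x` has a single nonzero coordinate, it is a multiple of that basis vector. -/
theorem HilbertBasis.eq_smul_of_inner_eq_zero {ι X : Type*} [NormedAddCommGroup X]
    [InnerProductSpace ℝ X] (φ : HilbertBasis ι ℝ X) {x : X} {j : ι}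
    (h : ∀ i, i ≠ j → ⟪x, φ i⟫ = 0) : x = ⟪x, φ j⟫ • φ j := by
  have hs := φ.hasSum_repr x
  have hs' := hasSum_single (f := fun i => φ.repr x i • φ i) j fun i hi => by
    simp [φ.repr_apply_apply, real_inner_comm, h i hi]
  have := hs.unique hs'
  rwa [φ.repr_apply_apply, real_inner_comm] at this

/-- Under the non-parallelism assumption, if `Px = Pφ_j`, `x ≠ φ_j`
and the weighted ℓ¹ series of `x` converges, then `∑_i w_i|⟨x,φ_i⟩| > w_j`. -/
theorem stmt_6
    {X : Type*} [NormedAddCommGroup X] [InnerProductSpace ℝ X]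
    (φ : HilbertBasis ℕ ℝ X) {k : ℕ} (v : Fin k → X) (hv : Orthonormal ℝ v)
    (P : X → X) (hP : ∀ x : X, P x = ∑ i : Fin k, ⟪x, v i⟫ • v i)
    (τ : ℝ) (hτ : 0 < τ)
    (w : ℕ → ℝ) (hw : ∀ i : ℕ, w i = max ‖P (φ i)‖ τ)
    (j : ℕ) (hj : τ ≤ ‖P (φ j)‖)
    (hpar : ∀ l q : ℕ, l ≠ q → ∀ c : ℝ, P (φ l) ≠ c • P (φ q))
    (x : X) (hx : P x = P (φ j)) (hxj : x ≠ φ j)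
    (hsum : Summable (fun i : ℕ => w i * |⟪x, φ i⟫|)) :
    w j < ∑' i : ℕ, w i * |⟪x, φ i⟫| := by
  set u := P (φ j) with hu
  have hu_pos : 0 < ‖u‖ := hτ.trans_le hj
  have hu0 : u ≠ 0 := norm_pos_iff.mp hu_pos
  have hinner (y : X) : ⟪P y, u⟫ = ⟪y, ∑ i, ⟪v i, u⟫ • v i⟫ := by
    simp [hP y, sum_inner, inner_sum, inner_smul_left, inner_smul_right, mul_comm]
  have hexp : HasSum (fun i => ⟪x, φ i⟫ * ⟪P (φ i), u⟫) (‖u‖ * ‖u‖) := by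
    rw [← real_inner_self_eq_norm_mul_norm]
    nth_rewrite 2 [← hx]
    simp only [hinner]
    exact φ.hasSum_inner_mul_inner x _
  obtain ⟨i, hij, hi⟩ : ∃ i, i ≠ j ∧ ⟪x, φ i⟫ ≠ 0 := by
    by_contra! h
    have hxs := φ.eq_smul_of_inner_eq_zero h
    have hPx : P x = ⟪x, φ j⟫ • u := by
      nth_rewrite 1 [hxs]
      simp only [hu, hP, inner_smul_left, Finset.smul_sum, smul_smul, conj_trivial]
    have hone : ⟪x, φ j⟫ = 1 :=
      smul_left_injective ℝ hu0 (by simp [← hPx, hx])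
    exact hxj (by rw [hxs, hone, one_smul])
  have hle (i : ℕ) : ⟪x, φ i⟫ * ⟪P (φ i), u⟫ ≤ w i * |⟪x, φ i⟫| * ‖u‖ := calc
    _ ≤ |⟪x, φ i⟫| * |⟪P (φ i), u⟫| := (le_abs_self _).trans_eq (abs_mul _ _)
    _ ≤ |⟪x, φ i⟫| * (‖P (φ i)‖ * ‖u‖) := by gcongr; exact abs_real_inner_le_norm _ _
    _ ≤ |⟪x, φ i⟫| * (w i * ‖u‖) := by gcongr; exact hw i ▸ le_max_left _ _
    _ = _ := by ring
  have hlt : ⟪x, φ i⟫ * ⟪P (φ i), u⟫ < w i * |⟪x, φ i⟫| * ‖u‖ := calc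
    _ ≤ |⟪x, φ i⟫| * |⟪P (φ i), u⟫| := (le_abs_self _).trans_eq (abs_mul _ _)
    _ < |⟪x, φ i⟫| * (‖P (φ i)‖ * ‖u‖) :=
      mul_lt_mul_of_pos_left (abs_real_inner_lt_norm_mul_norm hu0 (hpar i j hij))
        (abs_pos.mpr hi)
    _ ≤ |⟪x, φ i⟫| * (w i * ‖u‖) := by gcongr; exact hw i ▸ le_max_left _ _
    _ = _ := by ring
  have hfinal := hasSum_lt hle hlt hexp (hsum.hasSum.mul_right ‖u‖)
  rw [hw j, ← hu, max_eq_left hj]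
  exact lt_of_mul_lt_mul_right hfinal hu_pos.le
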